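/- arXiv:1811.12876 — 7 statements merged into one kernel-verified Lean document; each statement's English description precedes it below -/
import Mathlib

section
/- Let W ⊆ ℂ be a finite set closed under complex conjugation, let A ⊆ ℂ be a finite set closed under complex conjugation with A ∩ W = ∅, and let m : A → ℤ satisfy m(conj α) = m(α) for all α ∈ A. Fix w ∈ W with w real. Then the complex number P := (∏_{α ∈ A} (w − α)^{m(α)}) · (∏_{w' ∈ W, w' ≠ w} (w − w')) is a nonzero real number, and P > 0 if and only if the integer N := #{w' ∈ W : w' is real and w' > w} + Σ_{α ∈ A ∩ ℝ, α > w} m(α) is even. -/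
open scoped Classical

open scoped ComplexConjugate

theorem prod_zpow_eq_zpow_sum {ι K : Type*} [Field K] (s : Finset ι) (f : ι → ℤ) {a : K}
    (ha : a ≠ 0) : ∏ i ∈ s, a ^ f i = a ^ ∑ i ∈ s, f i := by
  induction s using Finset.induction_on with
  | empty => simp
  | insert i s hi ih => rw [Finset.prod_insert hi, Finset.sum_insert hi, ih, zpow_add₀ ha]

theorem exists_pos_sub_zpow_eq {r a : ℝ} (h : r ≠ a) (n : ℤ) :
    ∃ x : ℝ, 0 < x ∧ (r - a) ^ n = (if r < a then (-1) ^ n else 1) * x := by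
  refine ⟨|r - a| ^ n, zpow_pos (abs_pos.2 (sub_ne_zero.2 h)) n, ?_⟩
  split_ifs with hlt
  · rw [← mul_zpow, abs_of_neg (sub_neg.2 hlt)]
    ring_nf
  · rw [one_mul, abs_of_nonneg (sub_nonneg.2 (not_lt.1 hlt))]

theorem exists_pos_prod_real_sub_zpow_eq (S : Finset ℂ) (m : ℂ → ℤ) {r : ℝ} (hr : (r : ℂ) ∉ S) :
    ∃ x : ℝ, 0 < x ∧ ∏ α ∈ S with α.im = 0, ((r : ℂ) - α) ^ m α =
      ((-1 : ℝ) ^ (∑ α ∈ S with α.im = 0 ∧ r < α.re, m α) * x : ℝ) := by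
  have key : ∀ α ∈ S.filter (fun α => α.im = 0), ∃ x : ℝ, 0 < x ∧
      ((r : ℂ) - α) ^ m α = ((if r < α.re then (-1) ^ m α else 1) * x : ℝ) := by
    intro α hα
    rw [Finset.mem_filter] at hα
    have hre : ((α.re : ℝ) : ℂ) = α := Complex.ext rfl (by simp [hα.2])
    have hne : r ≠ α.re := by
      rintro rfl
      exact hr (hre ▸ hα.1)
    obtain ⟨x, hx, h⟩ := exists_pos_sub_zpow_eq hne (m α)
    refine ⟨x, hx, ?_⟩
    rw [← h]
    push_cast
    rw [hre]
  choose! x hx hprod using key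
  refine ⟨∏ α ∈ S with α.im = 0, x α, Finset.prod_pos hx, ?_⟩
  rw [Finset.prod_congr rfl hprod, ← Complex.ofReal_prod, Finset.prod_mul_distrib,
    ← Finset.prod_filter, Finset.filter_filter, prod_zpow_eq_zpow_sum _ _ (by norm_num)]

theorem exists_pos_prod_nonreal_sub_zpow_eq (S : Finset ℂ) (m : ℂ → ℤ)
    (hS : ∀ z ∈ S, conj z ∈ S) (hm : ∀ α ∈ S, m (conj α) = m α) (r : ℝ) :
    ∃ x : ℝ, 0 < x ∧ ∏ α ∈ S with α.im ≠ 0, ((r : ℂ) - α) ^ m α = x := by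
  have hconj : ∏ α ∈ S with α.im < 0, ((r : ℂ) - α) ^ m α =
      conj (∏ α ∈ S with 0 < α.im, ((r : ℂ) - α) ^ m α) := by
    rw [map_prod]
    refine Finset.prod_nbij' (fun z => conj z) (fun z => conj z) ?_ ?_ ?_ ?_ ?_
    · simpa using fun z hz h => ⟨hS z hz, h⟩
    · simpa using fun z hz h => ⟨hS z hz, h⟩
    · simp
    · simp
    · intro z hz
      simp [hm z (Finset.mem_filter.1 hz).1]
  have hsplit : S.filter (fun α => α.im ≠ 0) =
      S.filter (fun α => 0 < α.im) ∪ S.filter (fun α => α.im < 0) := by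
    ext z
    simp only [Finset.mem_filter, Finset.mem_union, ← and_or_left, ne_iff_lt_or_gt,
      or_comm]
  have hdisj : Disjoint (S.filter (fun α => 0 < α.im)) (S.filter (fun α => α.im < 0)) :=
    Finset.disjoint_filter.2 fun _ _ h => h.not_gt
  refine ⟨Complex.normSq (∏ α ∈ S with 0 < α.im, ((r : ℂ) - α) ^ m α), ?_, ?_⟩
  · refine Complex.normSq_pos.2 (Finset.prod_ne_zero_iff.2 fun α hα => zpow_ne_zero _ ?_)
    intro h
    have him := congrArg Complex.im h
    simp [(Finset.mem_filter.1 hα).2.ne'] at him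
  · rw [hsplit, Finset.prod_union hdisj, hconj, Complex.mul_conj]

theorem exists_pos_prod_sub_zpow_eq (S : Finset ℂ) (m : ℂ → ℤ)
    (hS : ∀ z ∈ S, conj z ∈ S) (hm : ∀ α ∈ S, m (conj α) = m α) {r : ℝ} (hr : (r : ℂ) ∉ S) :
    ∃ x : ℝ, 0 < x ∧ ∏ α ∈ S, ((r : ℂ) - α) ^ m α =
      ((-1 : ℝ) ^ (∑ α ∈ S with α.im = 0 ∧ r < α.re, m α) * x : ℝ) := by
  obtain ⟨x, hx, h₁⟩ := exists_pos_prod_real_sub_zpow_eq S m hr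
  obtain ⟨y, hy, h₂⟩ := exists_pos_prod_nonreal_sub_zpow_eq S m hS hm r
  refine ⟨x * y, mul_pos hx hy, ?_⟩
  rw [← Finset.prod_filter_mul_prod_filter_not S (fun α => α.im = 0), h₁, h₂,
    ← Complex.ofReal_mul, mul_assoc]

theorem sign_of_Q0_at_real_weierstrass_point
    (W A : Finset ℂ) (m : ℂ → ℤ)
    (hW : ∀ z ∈ W, (starRingEnd ℂ) z ∈ W)
    (hA : ∀ z ∈ A, (starRingEnd ℂ) z ∈ A)
    (hAW : A ∩ W = ∅)
    (hm : ∀ α ∈ A, m ((starRingEnd ℂ) α) = m α)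
    (w : ℂ) (hw : w ∈ W) (hwre : w.im = 0) :
    let P : ℂ := (∏ α ∈ A, (w - α) ^ (m α)) * ∏ w' ∈ W.erase w, (w - w')
    let N : ℤ := ((W.filter (fun w' => w'.im = 0 ∧ w.re < w'.re)).card : ℤ)
      + ∑ α ∈ A.filter (fun α => α.im = 0 ∧ w.re < α.re), m α
    P.im = 0 ∧ P ≠ 0 ∧ (0 < P.re ↔ Even N) := by
  intro P N
  obtain ⟨r, rfl⟩ : ∃ r : ℝ, w = r := ⟨w.re, Complex.ext rfl (by simp [hwre])⟩
  have hwA : (r : ℂ) ∉ A := fun h => by simpa [hAW] using Finset.mem_inter.2 ⟨h, hw⟩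
  have hWe : ∀ z ∈ W.erase (r : ℂ), conj z ∈ W.erase (r : ℂ) := by
    intro z hz
    rw [Finset.mem_erase] at hz ⊢
    refine ⟨fun h => hz.1 ?_, hW z hz.2⟩
    rw [← Complex.conj_conj z, h, Complex.conj_ofReal]
  obtain ⟨x, hx, hPA⟩ := exists_pos_prod_sub_zpow_eq A m hA hm hwA
  obtain ⟨y, hy, hPW⟩ := exists_pos_prod_sub_zpow_eq (W.erase (r : ℂ)) (fun _ => 1) hWe
    (fun _ _ => rfl) (Finset.notMem_erase _ _)
  have hfilter : (W.erase (r : ℂ)).filter (fun z => z.im = 0 ∧ r < z.re) =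
      W.filter (fun z => z.im = 0 ∧ r < z.re) := by
    rw [Finset.filter_erase, Finset.erase_eq_of_notMem (by simp)]
  simp only [zpow_one, hfilter, Finset.sum_const, nsmul_eq_mul, mul_one] at hPW
  have hP : P = ((-1 : ℝ) ^ N * (x * y) : ℝ) := by
    simp only [P, N, hPA, hPW, Complex.ofReal_re]
    rw [← Complex.ofReal_mul, zpow_add₀ (by norm_num)]
    congr 1
    ring
  have hxy : 0 < x * y := mul_pos hx hy
  rw [hP, Complex.ofReal_im, Complex.ofReal_re, Complex.ofReal_ne_zero]
  refine ⟨rfl, mul_ne_zero (zpow_ne_zero _ (by norm_num)) hxy.ne', ?_⟩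
  rw [mul_pos_iff_of_pos_right hxy]
  rcases Int.even_or_odd N with h | h
  · simp [h.neg_one_zpow, h]
  · have hneg : ¬ (0 : ℝ) < -1 := by norm_num
    simp only [h.neg_one_zpow, hneg, Int.not_even_iff_odd.2 h]
end

section
/- Let n, s ≥ 0 be natural numbers. Let r : Fin 2n → ℝ, let c : Fin 2n → ℝ with c(i) ≠ 0 for all i, let t : Fin s → ℂ, and let d : Fin s → ℂ with d(j) ≠ 0 for all j. On V = ℂ^{2n} × ℂ^{s} × ℂ^{s}, define the quadratic forms Q₀(x,y,z) = Σ_{i} c(i)·x_i² + Σ_{j} (d(j)·y_j² + conj(d(j))·z_j²) and Q₁(x,y,z) = Σ_{i} r(i)·c(i)·x_i² + Σ_{j} (t(j)·d(j)·y_j² + conj(t(j)·d(j))·z_j²), and let σ : V → V be the antilinear involution σ(x,y,z) = (conj∘x, conj∘z, conj∘y). Then there exists a ℂ-linear automorphism T of V such that σ ∘ T = T ∘ σ₀, where σ₀ is coordinatewise complex conjugation on V, and such that for all (x,y,z) ∈ V: Q₀(T(x,y,z)) = Σ_i sgn(c(i))·x_i² + Σ_j (y_j² − z_j²) and Q₁(T(x,y,z))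 = Σ_i sgn(c(i))·r(i)·x_i² + Σ_j (Re(t(j))·(y_j² − z_j²) + 2·Im(t(j))·y_j·z_j), where sgn(c(i)) ∈ {1,−1} is the sign of the nonzero real number c(i). -/
open ComplexConjugate in
/-- The change of coordinates rescaling the first factor by `a` and sending `(y, z)` to
`(e (y - i z), conj e (y + i z))` in the other two. -/
noncomputable def pencilEquiv {ι κ : Type*} (a : ι → ℂ) (e : κ → ℂ)
    (ha : ∀ i, a i ≠ 0) (he : ∀ j, e j ≠ 0) :
    ((ι → ℂ) × (κ → ℂ) × (κ → ℂ)) ≃ₗ[ℂ] ((ι → ℂ) × (κ → ℂ) × (κ → ℂ)) where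
  toFun v := (fun i => a i * v.1 i,
    fun j => e j * (v.2.1 j - Complex.I * v.2.2 j),
    fun j => conj (e j) * (v.2.1 j + Complex.I * v.2.2 j))
  invFun v := (fun i => (a i)⁻¹ * v.1 i,
    fun j => ((e j)⁻¹ * v.2.1 j + (conj (e j))⁻¹ * v.2.2 j) / 2,
    fun j => Complex.I * ((e j)⁻¹ * v.2.1 j - (conj (e j))⁻¹ * v.2.2 j) / 2)
  map_add' u v := by
    refine Prod.ext ?_ (Prod.ext ?_ ?_) <;> funext k <;> simp <;> ring
  map_smul' m v := by
    refine Prod.ext ?_ (Prod.ext ?_ ?_) <;> funext k <;> simp <;> ring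
  left_inv v := by
    have he' (j) : conj (e j) ≠ 0 := (map_ne_zero _).2 (he j)
    refine Prod.ext ?_ (Prod.ext ?_ ?_) <;> funext k
    · simp [ha k]
    · simp [he k]
    · simp only [inv_mul_cancel_left₀ (he k), inv_mul_cancel_left₀ (he' k)]
      linear_combination -v.2.2 k * Complex.I_sq
  right_inv v := by
    have he' (j) : conj (e j) ≠ 0 := (map_ne_zero _).2 (he j)
    refine Prod.ext ?_ (Prod.ext ?_ ?_) <;> funext k
    · simp [ha k]
    · have h := mul_inv_cancel₀ (he k)
      linear_combination v.2.1 k * h -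
        e k * ((e k)⁻¹ * v.2.1 k - (conj (e k))⁻¹ * v.2.2 k) / 2 * Complex.I_sq
    · have h := mul_inv_cancel₀ (he' k)
      linear_combination v.2.2 k * h +
        conj (e k) * ((e k)⁻¹ * v.2.1 k - (conj (e k))⁻¹ * v.2.2 k) / 2 * Complex.I_sq

theorem exists_ne_zero_mul_sq_eq_sign {c : ℝ} (hc : c ≠ 0) :
    ∃ a : ℝ, a ≠ 0 ∧ c * a ^ 2 = Real.sign c := by
  have h : 0 < |c| := abs_pos.2 hc
  refine ⟨(√|c|)⁻¹, by positivity, ?_⟩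
  rw [inv_pow, Real.sq_sqrt h.le]
  rcases hc.lt_or_gt with h | h
  · rw [Real.sign_of_neg h, abs_of_neg h]
    field_simp
  · rw [Real.sign_of_pos h, abs_of_pos h]
    field_simp

theorem exists_ne_zero_mul_sq_eq_half {d : ℂ} (hd : d ≠ 0) :
    ∃ e : ℂ, e ≠ 0 ∧ d * e ^ 2 = 1 / 2 := by
  obtain ⟨e, he⟩ := IsAlgClosed.exists_pow_nat_eq (1 / (2 * d)) two_pos
  have h : d * e ^ 2 = 1 / 2 := by
    rw [he]
    field_simp
  refine ⟨e, ?_, h⟩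
  rintro rfl
  norm_num at h

theorem real_normal_form_of_pencil (n s : ℕ)
    (r c : Fin (2*n) → ℝ) (hc : ∀ i, c i ≠ 0)
    (t d : Fin s → ℂ) (hd : ∀ j, d j ≠ 0) :
    let V := (Fin (2*n) → ℂ) × (Fin s → ℂ) × (Fin s → ℂ)
    let Q₀ : V → ℂ := fun v => ∑ i, (c i : ℂ) * (v.1 i) ^ 2
      + ∑ j, (d j * (v.2.1 j) ^ 2 + (starRingEnd ℂ) (d j) * (v.2.2 j) ^ 2)
    let Q₁ : V → ℂ := fun v => ∑ i, (r i : ℂ) * (c i : ℂ) * (v.1 i) ^ 2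
      + ∑ j, (t j * d j * (v.2.1 j) ^ 2 + (starRingEnd ℂ) (t j * d j) * (v.2.2 j) ^ 2)
    let σ : V → V := fun v =>
      (fun i => (starRingEnd ℂ) (v.1 i), fun j => (starRingEnd ℂ) (v.2.2 j),
       fun j => (starRingEnd ℂ) (v.2.1 j))
    let σ₀ : V → V := fun v =>
      (fun i => (starRingEnd ℂ) (v.1 i), fun j => (starRingEnd ℂ) (v.2.1 j),
       fun j => (starRingEnd ℂ) (v.2.2 j))
    ∃ T : V ≃ₗ[ℂ] V,
      (∀ v, σ (T v) = T (σ₀ v)) ∧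
      (∀ v : V, Q₀ (T v) = ∑ i, (Real.sign (c i) : ℂ) * (v.1 i) ^ 2
          + ∑ j, ((v.2.1 j) ^ 2 - (v.2.2 j) ^ 2)) ∧
      (∀ v : V, Q₁ (T v) = ∑ i, (Real.sign (c i) : ℂ) * (r i : ℂ) * (v.1 i) ^ 2
          + ∑ j, (((t j).re : ℂ) * ((v.2.1 j) ^ 2 - (v.2.2 j) ^ 2)
              + 2 * ((t j).im : ℂ) * (v.2.1 j) * (v.2.2 j))) := by
  intro V Q₀ Q₁ σ σ₀
  choose a ha hca using fun i => exists_ne_zero_mul_sq_eq_sign (hc i)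
  choose e he hde using fun j => exists_ne_zero_mul_sq_eq_half (hd j)
  have hca' (i) : (c i : ℂ) * (a i : ℂ) ^ 2 = (Real.sign (c i) : ℂ) := by
    exact_mod_cast congrArg Complex.ofReal (hca i)
  have hde' (j) : (starRingEnd ℂ) (d j) * (starRingEnd ℂ) (e j) ^ 2 = 1 / 2 := by
    simpa only [map_mul, map_pow, map_div₀, map_one, map_ofNat] using
      congrArg (starRingEnd ℂ) (hde j)
  refine ⟨pencilEquiv (fun i => (a i : ℂ)) e (fun i => Complex.ofReal_ne_zero.2 (ha i)) he,
    fun v => ?_, fun v => ?_, fun v => ?_⟩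
  · refine Prod.ext ?_ (Prod.ext ?_ ?_) <;> funext k <;> simp [σ, σ₀, pencilEquiv]
    ring_nf
    simp
  · refine congrArg₂ (· + ·) (Finset.sum_congr rfl fun i _ => ?_)
      (Finset.sum_congr rfl fun j _ => ?_)
    · simp only [pencilEquiv, LinearEquiv.coe_mk, LinearMap.coe_mk, AddHom.coe_mk]
      linear_combination v.1 i ^ 2 * hca' i
    · simp only [pencilEquiv, LinearEquiv.coe_mk, LinearMap.coe_mk, AddHom.coe_mk]
      linear_combination (v.2.1 j - Complex.I * v.2.2 j) ^ 2 * hde j +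
        (v.2.1 j + Complex.I * v.2.2 j) ^ 2 * hde' j + v.2.2 j ^ 2 * Complex.I_sq
  · refine congrArg₂ (· + ·) (Finset.sum_congr rfl fun i _ => ?_)
      (Finset.sum_congr rfl fun j _ => ?_)
    · simp only [pencilEquiv, LinearEquiv.coe_mk, LinearMap.coe_mk, AddHom.coe_mk]
      linear_combination r i * v.1 i ^ 2 * hca' i
    · have ht : t j = (t j).re + (t j).im * Complex.I := (Complex.re_add_im _).symm
      have ht' : (starRingEnd ℂ) (t j) = (t j).re - (t j).im * Complex.I := by
        apply Complex.ext <;> simp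
      simp only [pencilEquiv, LinearEquiv.coe_mk, LinearMap.coe_mk, AddHom.coe_mk, map_mul]
      linear_combination t j * (v.2.1 j - Complex.I * v.2.2 j) ^ 2 * hde j +
        (starRingEnd ℂ) (t j) * (v.2.1 j + Complex.I * v.2.2 j) ^ 2 * hde' j +
        (v.2.1 j - Complex.I * v.2.2 j) ^ 2 / 2 * ht +
        (v.2.1 j + Complex.I * v.2.2 j) ^ 2 / 2 * ht' +
        ((t j).re * v.2.2 j ^ 2 - 2 * (t j).im * v.2.1 j * v.2.2 j) * Complex.I_sq
end

section
/- Let n, s ≥ 0 be natural numbers, let ε : Fin n → {1, −1}, let r : Fin 2n → ℝ, let a : Fin s → ℝ and b : Fin s → ℝ with b(j) ≠ 0 for all j. Define real quadratic forms on ℝ^{2n+2s} with coordinates x₁,...,x_{2n}, z₁,...,z_s, w₁,...,w_s by q₀ = Σ_{i=1}^{n} ε(i)·(x_{2i−1}² − x_{2i}²) + Σ_{j=1}^{s} (z_j² − w_j²) and q₁ = Σ_{i=1}^{n} ε(i)·(r_{2i−1}·x_{2i−1}² − r_{2i}·x_{2i}²) + Σ_{j=1}^{s} (a_j·z_j² −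 a_j·w_j² + 2·b_j·z_j·w_j). Then for t ∈ ℂ, the complex quadratic form t·q₀ − q₁ on ℂ^{2n+2s} (extending the coefficients ℂ-bilinearly) is degenerate if and only if t ∈ {r_1, ..., r_{2n}} ∪ {a_j + i·b_j : 1 ≤ j ≤ s} ∪ {a_j − i·b_j : 1 ≤ j ≤ s}. -/
/-- A linear functional on `ℂ^(2n) × ℂ^s × ℂ^s`, with the first `2n` coordinates split into even and
odd ones, vanishes identically iff all its coefficients do. -/
theorem forall_sum_interleaved_eq_zero_iff {n s : ℕ} (o e : Fin n → Fin (2 * n))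
    (ho : ∀ i, (o i : ℕ) = 2 * i) (he : ∀ i, (e i : ℕ) = 2 * i + 1)
    (c d : Fin n → ℂ) (p q : Fin s → ℂ) :
    (∀ u : (Fin (2 * n) → ℂ) × (Fin s → ℂ) × (Fin s → ℂ),
      ∑ i, (c i * u.1 (o i) + d i * u.1 (e i)) + ∑ j, (p j * u.2.1 j + q j * u.2.2 j) = 0) ↔
      (∀ i, c i = 0) ∧ (∀ i, d i = 0) ∧ (∀ j, p j = 0) ∧ ∀ j, q j = 0 := by
  have hoo : ∀ i k, o i = o k ↔ i = k := fun i k => by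
    rw [Fin.ext_iff, Fin.ext_iff, ho, ho]; omega
  have hee : ∀ i k, e i = e k ↔ i = k := fun i k => by
    rw [Fin.ext_iff, Fin.ext_iff, he, he]; omega
  have hoe : ∀ i k, o i ≠ e k := fun i k h => by
    rw [Fin.ext_iff, ho, he] at h; omega
  have heo : ∀ i k, e i ≠ o k := fun i k => (hoe k i).symm
  constructor
  · intro h
    refine ⟨fun i => ?_, fun i => ?_, fun j => ?_, fun j => ?_⟩
    · simpa [Pi.single_apply, hoo, heo] using h (Pi.single (o i) 1, 0, 0)
    · simpa [Pi.single_apply, hee, hoe] using h (Pi.single (e i) 1, 0, 0)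
    · simpa [Pi.single_apply] using h (0, Pi.single j 1, 0)
    · simpa [Pi.single_apply] using h (0, 0, Pi.single j 1)
  · rintro ⟨hc, hd, hp, hq⟩ u
    simp [hc, hd, hp, hq]

theorem pencil_degenerate_iff_weierstrass (n s : ℕ)
    (ε : Fin n → ℝ) (hε : ∀ i, ε i = 1 ∨ ε i = -1)
    (r : Fin (2*n) → ℝ) (a b : Fin s → ℝ) (hb : ∀ j, b j ≠ 0) (t : ℂ) :
    let V := (Fin (2*n) → ℂ) × (Fin s → ℂ) × (Fin s → ℂ)
    let o : Fin n → Fin (2*n) := fun i => ⟨2*i.1, by omega⟩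
    let e : Fin n → Fin (2*n) := fun i => ⟨2*i.1 + 1, by omega⟩
    let q₀ : V → ℂ := fun v => ∑ i, (ε i : ℂ) * ((v.1 (o i)) ^ 2 - (v.1 (e i)) ^ 2)
      + ∑ j, ((v.2.1 j) ^ 2 - (v.2.2 j) ^ 2)
    let q₁ : V → ℂ := fun v =>
      ∑ i, (ε i : ℂ) * ((r (o i) : ℂ) * (v.1 (o i)) ^ 2 - (r (e i) : ℂ) * (v.1 (e i)) ^ 2)
      + ∑ j, ((a j : ℂ) * (v.2.1 j) ^ 2 - (a j : ℂ) * (v.2.2 j) ^ 2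
          + 2 * (b j : ℂ) * (v.2.1 j) * (v.2.2 j))
    let Q : V → ℂ := fun v => t * q₀ v - q₁ v
    (∃ v : V, v ≠ 0 ∧ ∀ u : V, Q (v + u) - Q v - Q u = 0) ↔
      ((∃ i : Fin (2*n), t = (r i : ℂ)) ∨
       (∃ j : Fin s, t = (a j : ℂ) + (b j : ℂ) * Complex.I) ∨
       (∃ j : Fin s, t = (a j : ℂ) - (b j : ℂ) * Complex.I)) := by
  intro V o e q₀ q₁ Q
  have polar : ∀ v u : V, Q (v + u) - Q v - Q u =
      ∑ i, ((2 * ε i * ((t - r (o i)) * v.1 (o i))) * u.1 (o i)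
          + (-2 * ε i * ((t - r (e i)) * v.1 (e i))) * u.1 (e i))
      + ∑ j, ((2 * ((t - a j) * v.2.1 j - b j * v.2.2 j)) * u.2.1 j
          + (-2 * ((t - a j) * v.2.2 j + b j * v.2.1 j)) * u.2.2 j) := by
    intro v u
    have hx : ∀ k, (v + u).1 k = v.1 k + u.1 k := fun _ => rfl
    have hz : ∀ k, (v + u).2.1 k = v.2.1 k + u.2.1 k := fun _ => rfl
    have hw : ∀ k, (v + u).2.2 k = v.2.2 k + u.2.2 k := fun _ => rfl
    simp only [Q, q₀, q₁, mul_add, Finset.mul_sum, add_sub_add_comm, ← Finset.sum_sub_distrib]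
    congr 1 <;> refine Finset.sum_congr rfl fun i _ => ?_ <;>
      simp only [hx, hz, hw] <;> ring
  have hε' : ∀ i, (ε i : ℂ) ≠ 0 := fun i => by
    rcases hε i with h | h <;> simp [h]
  have cover : ∀ k : Fin (2 * n), (∃ i, o i = k) ∨ ∃ i, e i = k := by
    intro k
    rcases Nat.even_or_odd' k.1 with ⟨m, hm | hm⟩
    · exact Or.inl ⟨⟨m, by omega⟩, Fin.ext hm.symm⟩
    · exact Or.inr ⟨⟨m, by omega⟩, Fin.ext hm.symm⟩
  have radical : ∀ v : V, (∀ u : V, Q (v + u) - Q v - Q u = 0) ↔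
      (∀ k, (t - r k) * v.1 k = 0) ∧ (∀ j, (t - a j) * v.2.1 j - b j * v.2.2 j = 0) ∧
        ∀ j, (t - a j) * v.2.2 j + b j * v.2.1 j = 0 := by
    intro v
    simp only [polar]
    refine (forall_sum_interleaved_eq_zero_iff o e (fun _ => rfl) (fun _ => rfl) _ _ _ _).trans ?_
    have ho : ∀ i (x : ℂ), 2 * (ε i : ℂ) * x = 0 ↔ x = 0 := fun i x => by simp [hε']
    have he : ∀ i (x : ℂ), -2 * (ε i : ℂ) * x = 0 ↔ x = 0 := fun i x => by simp [hε']
    have hz : ∀ x : ℂ, 2 * x = 0 ↔ x = 0 := fun x => by simp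
    have hw : ∀ x : ℂ, -2 * x = 0 ↔ x = 0 := fun x => by simp
    simp only [ho, he, hz, hw]
    constructor
    · rintro ⟨h₁, h₂, h₃, h₄⟩
      refine ⟨fun k => ?_, h₃, h₄⟩
      rcases cover k with ⟨i, rfl⟩ | ⟨i, rfl⟩
      · exact h₁ i
      · exact h₂ i
    · rintro ⟨h₁, h₃, h₄⟩
      exact ⟨fun i => h₁ _, fun i => h₁ _, h₃, h₄⟩
  simp only [radical]
  constructor
  · rintro ⟨v, hv, h₁, h₂, h₃⟩
    by_contra! hne
    obtain ⟨hr, hp, hm⟩ := hne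
    have hdet : ∀ j, (t - a j) ^ 2 + (b j : ℂ) ^ 2 ≠ 0 := by
      intro j h
      have : (t - (a j + b j * Complex.I)) * (t - (a j - b j * Complex.I)) = 0 := by
        linear_combination h - (b j : ℂ) ^ 2 * Complex.I_sq
      rcases mul_eq_zero.mp this with h' | h'
      · exact hp j (sub_eq_zero.mp h')
      · exact hm j (sub_eq_zero.mp h')
    refine hv (Prod.ext (funext fun k => ?_) (Prod.ext (funext fun j => ?_) (funext fun j => ?_)))
    · exact (mul_eq_zero.mp (h₁ k)).resolve_left (sub_ne_zero.mpr (hr k))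
    · refine (mul_eq_zero.mp (?_ : ((t - a j) ^ 2 + (b j : ℂ) ^ 2) * v.2.1 j = 0)).resolve_left
        (hdet j)
      linear_combination (t - a j) * h₂ j + (b j : ℂ) * h₃ j
    · refine (mul_eq_zero.mp (?_ : ((t - a j) ^ 2 + (b j : ℂ) ^ 2) * v.2.2 j = 0)).resolve_left
        (hdet j)
      linear_combination (t - a j) * h₃ j - (b j : ℂ) * h₂ j
  · have block : ∀ (j : Fin s) (c : ℂ), c ^ 2 = -1 → t = a j + b j * c →
        ∃ v : V, v ≠ 0 ∧ (∀ k, (t - r k) * v.1 k = 0) ∧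
          (∀ j, (t - a j) * v.2.1 j - b j * v.2.2 j = 0) ∧
          ∀ j, (t - a j) * v.2.2 j + b j * v.2.1 j = 0 := by
      intro j c hc ht
      refine ⟨(0, Pi.single j 1, Pi.single j c), fun h => ?_, fun k => by simp, fun k => ?_,
        fun k => ?_⟩
      · simpa using congrFun (congrArg (fun v : V => v.2.1) h) j
      · rcases eq_or_ne k j with rfl | hk
        · simp [ht]
        · simp [hk]
      · rcases eq_or_ne k j with rfl | hk
        · simp only [ht, Pi.single_eq_same]
          linear_combination (b k : ℂ) * hc
        · simp [hk]
    rintro (⟨k, rfl⟩ | ⟨j, hj⟩ | ⟨j, hj⟩)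
    · refine ⟨(Pi.single k 1, 0, 0), fun h => ?_, fun l => ?_, fun j => by simp, fun j => by simp⟩
      · simpa using congrFun (congrArg Prod.fst h) k
      · rcases eq_or_ne l k with rfl | hl
        · simp
        · simp [hl]
    · exact block j Complex.I Complex.I_sq hj
    · exact block j (-Complex.I) (by simp) (by rw [hj]; ring)
end

section
/- Let g ≥ 2 and 1 ≤ n ≤ g+1. Let f(x) = ∏_{i=1}^{2n}(x − r_i) · ∏_{j=1}^{g+1−n}((x − a_j)² + b_j²), where r_1 < r_2 < ... < r_{2n} are real numbers, a_j ∈ ℝ, b_j > 0, and the 2g+2 complex roots r_1,...,r_{2n}, a_1 ± i·b_1, ..., a_{g+1−n} ± i·b_{g+1−n} are pairwise distinct. Then the set {(x,y) ∈ ℝ × ℝ : y² = −f(x)} has exactly n connected components. -/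
/-- A continuous map to a discrete space with connected fibres identifies the connected components
of its domain with its codomain. -/
theorem card_connectedComponents_eq_of_isConnected_fibers {X ι : Type*} [TopologicalSpace X]
    [TopologicalSpace ι] [DiscreteTopology ι] {c : X → ι} (hc : Continuous c)
    (h : ∀ i, IsConnected (c ⁻¹' {i})) :
    Nat.card (ConnectedComponents X) = Nat.card ι := by
  refine Nat.card_eq_of_bijective hc.connectedComponentsLift ⟨fun u v huv => ?_, fun i => ?_⟩
  · obtain ⟨x, rfl⟩ := ConnectedComponents.surjective_coe u
    obtain ⟨y, rfl⟩ := ConnectedComponents.surjective_coe v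
    simp only [Continuous.connectedComponentsLift_apply_coe] at huv
    rw [ConnectedComponents.coe_eq_coe']
    exact (h (c y)).isPreconnected.subset_connectedComponent rfl huv
  · obtain ⟨x, hx⟩ := (h i).nonempty
    exact ⟨x, by simpa using hx⟩

/-- The part of the curve `y ^ 2 = q x` over an interval on which `q` is nonnegative, and at whose
left endpoint `q` vanishes, is connected. -/
theorem isConnected_sq_eq_over_Icc {q : ℝ → ℝ} (hq : Continuous q) {a b : ℝ} (hab : a ≤ b)
    (hpos : ∀ x ∈ Set.Icc a b, 0 ≤ q x) (ha : q a = 0) :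
    IsConnected {p : ℝ × ℝ | p.2 ^ 2 = q p.1 ∧ p.1 ∈ Set.Icc a b} := by
  have hset : {p : ℝ × ℝ | p.2 ^ 2 = q p.1 ∧ p.1 ∈ Set.Icc a b} =
      (fun x => (x, √(q x))) '' Set.Icc a b ∪ (fun x => (x, -√(q x))) '' Set.Icc a b := by
    ext ⟨x, y⟩
    simp only [Set.mem_ofPred_eq, Set.mem_union, Set.mem_image, Prod.mk.injEq]
    constructor
    · rintro ⟨hy, hx⟩
      rw [← Real.sq_sqrt (hpos x hx), sq_eq_sq_iff_eq_or_eq_neg] at hy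
      exact hy.imp (fun h => ⟨x, hx, rfl, h.symm⟩) fun h => ⟨x, hx, rfl, h.symm⟩
    · rintro (⟨_, hx, rfl, rfl⟩ | ⟨_, hx, rfl, rfl⟩)
      · exact ⟨Real.sq_sqrt (hpos _ hx), hx⟩
      · exact ⟨by rw [neg_sq, Real.sq_sqrt (hpos _ hx)], hx⟩
  have hmem : a ∈ Set.Icc a b := Set.left_mem_Icc.2 hab
  rw [hset]
  refine IsConnected.union ⟨(a, 0), ⟨a, hmem, by simp [ha]⟩, ⟨a, hmem, by simp [ha]⟩⟩ ?_ ?_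
  · exact (isConnected_Icc hab).image _ (by fun_prop)
  · exact (isConnected_Icc hab).image _ (by fun_prop)

/-- If `q` is nonnegative exactly on a finite disjoint union of intervals, and vanishes at their
left endpoints, then the curve `y ^ 2 = q x` has one connected component per interval. -/
theorem card_connectedComponents_sq_eq {ι : Type*} [Finite ι] {q : ℝ → ℝ} (hq : Continuous q)
    {α β : ι → ℝ} (hαβ : ∀ k, α k ≤ β k)
    (hdisj : Pairwise fun j k => Disjoint (Set.Icc (α j) (β j)) (Set.Icc (α k) (β k)))
    (hpos : ∀ x, 0 ≤ q x ↔ ∃ k, x ∈ Set.Icc (α k) (β k)) (hzero : ∀ k, q (α k) = 0) :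
    Nat.card (ConnectedComponents {p : ℝ × ℝ // p.2 ^ 2 = q p.1}) = Nat.card ι := by
  let _ : TopologicalSpace ι := ⊥
  have : DiscreteTopology ι := ⟨rfl⟩
  have hex : ∀ p : {p : ℝ × ℝ // p.2 ^ 2 = q p.1}, ∃ k, p.1.1 ∈ Set.Icc (α k) (β k) :=
    fun p => (hpos _).1 (p.2 ▸ sq_nonneg _)
  choose c hc using hex
  have hiff : ∀ p k, c p = k ↔ p.1.1 ∈ Set.Icc (α k) (β k) := fun p k =>
    ⟨fun h => h ▸ hc p, fun h => by
      by_contra hne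
      exact Set.disjoint_left.1 (hdisj hne) (hc p) h⟩
  have hfib : ∀ k, c ⁻¹' {k} = {p | p.1.1 ∈ Set.Icc (α k) (β k)} := fun k => by
    ext p
    exact hiff p k
  have hcont : Continuous c := by
    refine continuous_iff_isClosed.2 fun s _ => ?_
    rw [← Set.biUnion_preimage_singleton]
    refine s.toFinite.isClosed_biUnion fun k _ => ?_
    rw [hfib]
    exact isClosed_Icc.preimage (by fun_prop)
  refine card_connectedComponents_eq_of_isConnected_fibers hcont fun k => ?_
  have himage : Subtype.val '' (c ⁻¹' {k}) =
      {p : ℝ × ℝ | p.2 ^ 2 = q p.1 ∧ p.1 ∈ Set.Icc (α k) (β k)} := by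
    rw [hfib]
    ext p
    simpa using and_comm
  have hconn := isConnected_sq_eq_over_Icc hq (hαβ k) (fun x hx => (hpos x).2 ⟨k, hx⟩) (hzero k)
  rw [← himage] at hconn
  exact ⟨hconn.nonempty.of_image,
    Topology.IsInducing.subtypeVal.isPreconnected_image.1 hconn.isPreconnected⟩

/-- A product of quadratics `(x - α k) * (x - β k)` with disjoint root intervals is nonpositive
exactly on the union of these intervals. -/
theorem prod_sub_mul_sub_nonpos_iff {ι : Type*} [Fintype ι] {α β : ι → ℝ} (hαβ : ∀ k, α k ≤ β k)
    (hdisj : Pairwise fun j k => Disjoint (Set.Icc (α j) (β j)) (Set.Icc (α k) (β k))) (x : ℝ) :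
    ∏ k, ((x - α k) * (x - β k)) ≤ 0 ↔ ∃ k, x ∈ Set.Icc (α k) (β k) := by
  classical
  have hout : ∀ k, x ∉ Set.Icc (α k) (β k) → 0 < (x - α k) * (x - β k) := fun k hk => by
    rcases lt_or_ge x (α k) with h | h
    · exact mul_pos_of_neg_of_neg (by linarith) (by linarith [hαβ k])
    · have : β k < x := not_le.1 fun h' => hk ⟨h, h'⟩
      exact mul_pos (by linarith [hαβ k]) (by linarith)
  constructor
  · contrapose!
    exact fun h => Finset.prod_pos fun k _ => hout k (h k)
  · rintro ⟨k, hk⟩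
    rw [← Finset.mul_prod_erase _ _ (Finset.mem_univ k)]
    refine mul_nonpos_of_nonpos_of_nonneg
      (mul_nonpos_of_nonneg_of_nonpos (by linarith [hk.1]) (by linarith [hk.2]))
      (Finset.prod_nonneg fun j hj => (hout j fun hx => ?_).le)
    exact Set.disjoint_left.1 (hdisj (Finset.ne_of_mem_erase hj)) hx hk

/-- A product over `Fin (2 * n)`, grouped into consecutive pairs of factors. -/
theorem Fin.prod_univ_two_mul {M : Type*} [CommMonoid M] {n : ℕ} (f : Fin (2 * n) → M) :
    ∏ i, f i = ∏ k : Fin n, f ⟨2 * k, by omega⟩ * f ⟨2 * k + 1, by omega⟩ := by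
  rw [← Equiv.prod_comp (finProdFinEquiv.trans (finCongr (mul_comm n 2))), Fintype.prod_prod_type]
  refine Finset.prod_congr rfl fun k _ => ?_
  rw [Fin.prod_univ_two]
  congr 2
  · ext
    simp
  · ext
    simp [add_comm]

theorem real_locus_components_tau_iota (g n : ℕ) (hg : 2 ≤ g) (hn1 : 1 ≤ n) (hn2 : n ≤ g + 1)
    (r : Fin (2*n) → ℝ) (hr : StrictMono r)
    (a b : Fin (g+1-n) → ℝ) (hb : ∀ j, 0 < b j)
    (hdist : Function.Injective
      (Sum.elim (fun i : Fin (2*n) => (r i : ℂ))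
        (Sum.elim (fun j : Fin (g+1-n) => (a j : ℂ) + (b j : ℂ) * Complex.I)
          (fun j : Fin (g+1-n) => (a j : ℂ) - (b j : ℂ) * Complex.I)))) :
    Nat.card (ConnectedComponents
      {p : ℝ × ℝ // p.2 ^ 2 = -((∏ i, (p.1 - r i)) * ∏ j, ((p.1 - a j) ^ 2 + (b j) ^ 2))})
      = n := by
  have hdisj : Pairwise fun j k : Fin n =>
      Disjoint (Set.Icc (r ⟨2 * j, by omega⟩) (r ⟨2 * j + 1, by omega⟩))
        (Set.Icc (r ⟨2 * k, by omega⟩) (r ⟨2 * k + 1, by omega⟩)) := by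
    have hlt : ∀ j k : Fin n, j < k →
        Disjoint (Set.Icc (r ⟨2 * j, by omega⟩) (r ⟨2 * j + 1, by omega⟩))
          (Set.Icc (r ⟨2 * k, by omega⟩) (r ⟨2 * k + 1, by omega⟩)) := fun j k hjk => by
      have h : r ⟨2 * j + 1, by omega⟩ < r ⟨2 * k, by omega⟩ := hr (by
        simp only [Fin.mk_lt_mk]
        omega)
      exact Set.disjoint_left.2 fun x hx hx' => absurd (hx'.1.trans hx.2) (not_le.2 h)
    exact fun j k hjk => hjk.lt_or_gt.elim (hlt j k) fun h => (hlt k j h).symm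
  have hle : ∀ k : Fin n, r ⟨2 * k, by omega⟩ ≤ r ⟨2 * k + 1, by omega⟩ :=
    fun k => hr.monotone (by simp)
  have hquad : ∀ x : ℝ, 0 < ∏ j, ((x - a j) ^ 2 + (b j) ^ 2) := fun x =>
    Finset.prod_pos fun j _ => add_pos_of_nonneg_of_pos (sq_nonneg _) (pow_pos (hb j) 2)
  have hcard := card_connectedComponents_sq_eq
    (q := fun x => -((∏ i, (x - r i)) * ∏ j, ((x - a j) ^ 2 + (b j) ^ 2)))
    (by fun_prop) hle hdisj ?_ ?_
  · rwa [Nat.card_fin] at hcard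
  · intro x
    rw [← prod_sub_mul_sub_nonpos_iff hle hdisj, ← Fin.prod_univ_two_mul fun i => x - r i,
      neg_nonneg, ← not_lt, ← not_lt, mul_pos_iff_of_pos_right (hquad x)]
  · intro k
    rw [Finset.prod_eq_zero (Finset.mem_univ _) (sub_self _), zero_mul, neg_zero]
end

section
/- Let g ≥ 2 and 1 ≤ n ≤ g. Let f(x) = ∏_{i=1}^{2n}(x − r_i) · ∏_{j=1}^{g+1−n}((x − a_j)² + b_j²), where r_1 < r_2 < ... < r_{2n} are real numbers, a_j ∈ ℝ, b_j > 0, and the 2g+2 complex roots r_1,...,r_{2n}, a_1 ± i·b_1, ..., a_{g+1−n} ± i·b_{g+1−n} are pairwise distinct. Then the set {(x,y) ∈ ℂ × ℂ : y² = f(x)} \ (ℝ × ℝ) is connected. -/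
/-- The principal square root is continuous along every horizontal line. -/
theorem continuous_cpow_half_horizontal (w : ℂ) :
    Continuous fun t : ℝ => (w + (t : ℂ)) ^ (1 / 2 : ℂ) := by
  by_cases hw : w.im < 0
  · refine Continuous.cpow (by fun_prop) continuous_const fun t => ?_
    exact Complex.mem_slitPlane_iff.2 (Or.inr (by simpa using hw.ne))
  · push Not at hw
    rw [continuous_iff_continuousAt]
    intro t
    by_cases h0 : w + (t : ℂ) = 0
    · have h := Complex.continuousAt_cpow_const_of_re_pos (z := w + (t : ℂ))
        (w := (1 / 2 : ℂ)) (Or.inl (by simp [h0])) (by norm_num)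
      exact ContinuousAt.comp (f := fun s : ℝ => w + (s : ℂ)) h (by fun_prop)
    · have hcont : ContinuousOn (fun z : ℂ => z ^ (1 / 2 : ℂ)) ({z : ℂ | 0 ≤ z.im} \ {0}) := by
        have hexp : ContinuousOn (fun z : ℂ => Complex.exp (Complex.log z * (1 / 2)))
            ({z : ℂ | 0 ≤ z.im} \ {0}) := by
          refine Complex.continuous_exp.comp_continuousOn (ContinuousOn.mul ?_ continuousOn_const)
          intro z hz
          by_cases hs : z ∈ Complex.slitPlane
          · exact (continuousAt_clog hs).continuousWithinAt
          · rw [Complex.mem_slitPlane_iff] at hs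
            push Not at hs
            have hre : z.re < 0 :=
              lt_of_le_of_ne hs.1 fun h => hz.2 (Complex.ext h hs.2)
            exact (Complex.continuousWithinAt_log_of_re_neg_of_im_zero hre hs.2).mono
              Set.sdiff_subset
        exact hexp.congr fun z hz => Complex.cpow_def_of_ne_zero hz.2 _
      have hmaps : ∀ᶠ s : ℝ in nhds t, w + (s : ℂ) ∈ {z : ℂ | 0 ≤ z.im} \ {0} := by
        have hne : ∀ᶠ s : ℝ in nhds t, w + (s : ℂ) ≠ 0 :=
          ContinuousAt.eventually_ne (by fun_prop) h0
        filter_upwards [hne] with s hs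
        exact ⟨by simpa using hw, hs⟩
      have hlim : Filter.Tendsto (fun s : ℝ => w + (s : ℂ)) (nhds t)
          (nhdsWithin (w + (t : ℂ)) ({z : ℂ | 0 ≤ z.im} \ {0})) :=
        tendsto_nhdsWithin_iff.2
          ⟨(by fun_prop : Continuous fun s : ℝ => w + (s : ℂ)).continuousAt, hmaps⟩
      exact (hcont _ hmaps.self_of_nhds).tendsto.comp hlim

/-- `F` has a continuous square root along every real line in `ℂ`. -/
def HasSqrtAlongLines (F : ℂ → ℂ) : Prop :=
  ∀ x q : ℂ, q ≠ 0 → ∃ Y : ℝ → ℂ, Continuous Y ∧ ∀ t : ℝ, Y t ^ 2 = F (x + t * q)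

theorem hasSqrtAlongLines_sub_const (ρ : ℂ) : HasSqrtAlongLines fun z => z - ρ := by
  intro x q hq
  refine ⟨fun t => q ^ (1 / 2 : ℂ) * ((x - ρ) / q + (t : ℂ)) ^ (1 / 2 : ℂ),
    continuous_const.mul (continuous_cpow_half_horizontal _), fun t => ?_⟩
  have hsq (z : ℂ) : (z ^ (1 / 2 : ℂ)) ^ 2 = z := by
    rw [one_div]; exact Complex.cpow_nat_inv_pow z two_ne_zero
  rw [mul_pow, hsq, hsq]
  field_simp
  ring

theorem HasSqrtAlongLines.mul {F G : ℂ → ℂ} (hF : HasSqrtAlongLines F)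
    (hG : HasSqrtAlongLines G) : HasSqrtAlongLines fun z => F z * G z := by
  intro x q hq
  obtain ⟨Y, hY, hYF⟩ := hF x q hq
  obtain ⟨Z, hZ, hZG⟩ := hG x q hq
  exact ⟨fun t => Y t * Z t, hY.mul hZ, fun t => by rw [mul_pow, hYF, hZG]⟩

theorem HasSqrtAlongLines.prod {ι : Type*} [Fintype ι] {F : ι → ℂ → ℂ}
    (hF : ∀ i, HasSqrtAlongLines (F i)) : HasSqrtAlongLines fun z => ∏ i, F i z := by
  intro x q hq
  choose Y hY hYF using fun i => hF i x q hq
  exact ⟨fun t => ∏ i, Y i t, continuous_finsetProd _ fun i _ => hY i, fun t => by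
    rw [← Finset.prod_pow]; exact Finset.prod_congr rfl fun i _ => hYF i t⟩

/-- A point of `y ^ 2 = F x` off the real locus is joined, off the real locus, to any nonreal zero
of `F` lying in the same closed half-plane. -/
theorem HasSqrtAlongLines.joinedIn_zero {F : ℂ → ℂ} (hF : HasSqrtAlongLines F) {c : ℂ}
    (hc : F c = 0) (hcim : c.im ≠ 0) {p : ℂ × ℂ}
    (hp : p ∈ {p : ℂ × ℂ | p.2 ^ 2 = F p.1} \ {p : ℂ × ℂ | p.1.im = 0 ∧ p.2.im = 0})
    (hside : 0 ≤ p.1.im * c.im) :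
    JoinedIn ({p : ℂ × ℂ | p.2 ^ 2 = F p.1} \ {p : ℂ × ℂ | p.1.im = 0 ∧ p.2.im = 0})
      p (c, 0) := by
  obtain ⟨x, y⟩ := p
  have hy : y ^ 2 = F x := hp.1
  by_cases hxc : x = c
  · subst hxc
    have hy0 : y = 0 := by simpa [hc] using hy
    subst hy0
    exact JoinedIn.refl hp
  obtain ⟨Y, hYc, hYF⟩ : ∃ Y : ℝ → ℂ, Continuous Y ∧ Y 0 = y ∧
      ∀ t : ℝ, Y t ^ 2 = F (x + t * (c - x)) := by
    obtain ⟨Y, hYc, hYF⟩ := hF x (c - x) (sub_ne_zero.2 (Ne.symm hxc))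
    have h0 : Y 0 ^ 2 = y ^ 2 := by rw [hYF, hy]; simp
    rcases sq_eq_sq_iff_eq_or_eq_neg.1 h0 with h | h
    · exact ⟨Y, hYc, h, hYF⟩
    · exact ⟨fun t => -Y t, hYc.neg, by simp [h], fun t => by rw [neg_sq, hYF]⟩
  obtain ⟨hY0, hYF⟩ := hYF
  have hY1 : Y 1 = 0 := by simpa [hc] using hYF 1
  refine JoinedIn.ofLine (f := fun t : ℝ => (x + t * (c - x), Y t))
    (by fun_prop) (by simp [hY0]) (by simp [hY1]) ?_
  rintro _ ⟨t, ⟨ht0, ht1⟩, rfl⟩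
  refine ⟨hYF t, ?_⟩
  rintro ⟨him, him'⟩
  rcases ht0.eq_or_lt with rfl | ht
  · exact hp.2 ⟨by simpa using him, by simpa [hY0] using him'⟩
  · have him : x.im + t * (c.im - x.im) = 0 := by simpa using him
    have hpos : 0 < c.im * c.im := mul_self_pos.2 hcim
    have hside : 0 ≤ x.im * c.im := hside
    have hmul : (1 - t) * (x.im * c.im) + t * (c.im * c.im) = 0 := by
      linear_combination c.im * him
    linarith [mul_pos ht hpos, mul_nonneg (sub_nonneg.2 ht1) hside]

/-- If `r` is strictly monotone on an even, positive number of indices, then `∏ (x - r i)` takes a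
negative value. -/
theorem exists_prod_sub_neg {n : ℕ} (hn : 1 ≤ n) {r : Fin (2 * n) → ℝ} (hr : StrictMono r) :
    ∃ x : ℝ, ∏ i, (x - r i) < 0 := by
  obtain ⟨m, rfl⟩ : ∃ m, n = m + 1 := ⟨n - 1, by omega⟩
  change Fin (2 * m + 1 + 1) → ℝ at r
  change StrictMono r at hr
  obtain ⟨x, h0, h1⟩ := exists_between (hr (Fin.succ_pos 0 : (0 : Fin (2 * m + 1 + 1)) < _))
  refine ⟨x, ?_⟩
  change ∏ i : Fin (2 * m + 1 + 1), (x - r i) < 0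
  rw [Fin.prod_univ_succ]
  refine mul_neg_of_pos_of_neg (sub_pos.2 h0) ?_
  have hprod : 0 < ∏ i : Fin (2 * m + 1), (r i.succ - x) :=
    Finset.prod_pos fun i _ => sub_pos.2 <| h1.trans_le <|
      hr.monotone (Fin.succ_le_succ_iff.2 (Fin.zero_le i))
  have hneg : ∏ i : Fin (2 * m + 1), (x - r i.succ) = -∏ i : Fin (2 * m + 1), (r i.succ - x) := by
    simp_rw [← neg_sub (r _) x]
    rw [Finset.prod_neg]
    simp [pow_succ]
  rw [hneg]
  exact neg_lt_zero.2 hprod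

theorem complement_of_real_locus_connected (g n : ℕ) (hg : 2 ≤ g) (hn1 : 1 ≤ n) (hn2 : n ≤ g)
    (r : Fin (2*n) → ℝ) (hr : StrictMono r)
    (a b : Fin (g+1-n) → ℝ) (hb : ∀ j, 0 < b j)
    (hdist : Function.Injective
      (Sum.elim (fun i : Fin (2*n) => (r i : ℂ))
        (Sum.elim (fun j : Fin (g+1-n) => (a j : ℂ) + (b j : ℂ) * Complex.I)
          (fun j : Fin (g+1-n) => (a j : ℂ) - (b j : ℂ) * Complex.I)))) :
    IsConnected
      ({p : ℂ × ℂ | p.2 ^ 2 = (∏ i, (p.1 - (r i : ℂ))) * ∏ j, ((p.1 - (a j : ℂ)) ^ 2 + ((b j : ℂ)) ^ 2)}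
        \ {p : ℂ × ℂ | p.1.im = 0 ∧ p.2.im = 0}) := by
  set F : ℂ → ℂ := fun z =>
    (∏ i, (z - (r i : ℂ))) * ∏ j, ((z - (a j : ℂ)) ^ 2 + ((b j : ℂ)) ^ 2) with hFdef
  have hfactor (z : ℂ) (j : Fin (g + 1 - n)) : (z - (a j : ℂ)) ^ 2 + (b j : ℂ) ^ 2 =
      (z - (a j + b j * Complex.I)) * (z - (a j - b j * Complex.I)) := by
    linear_combination (b j : ℂ) ^ 2 * Complex.I_sq
  have hF : HasSqrtAlongLines F := by
    simp only [hFdef, hfactor]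
    exact (HasSqrtAlongLines.prod fun i => hasSqrtAlongLines_sub_const _).mul
      (HasSqrtAlongLines.prod fun j =>
        (hasSqrtAlongLines_sub_const _).mul (hasSqrtAlongLines_sub_const _))
  let j₀ : Fin (g + 1 - n) := ⟨0, by omega⟩
  have hzero (c : ℂ) (h : (c - (a j₀ : ℂ)) ^ 2 + (b j₀ : ℂ) ^ 2 = 0) : F c = 0 :=
    mul_eq_zero_of_right _ (Finset.prod_eq_zero (Finset.mem_univ j₀) h)
  have hup : F (a j₀ + b j₀ * Complex.I) = 0 := hzero _ (by rw [hfactor]; ring)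
  have hlow : F (a j₀ - b j₀ * Complex.I) = 0 := hzero _ (by rw [hfactor]; ring)
  have hupim : (a j₀ + b j₀ * Complex.I : ℂ).im = b j₀ := by simp
  have hlowim : (a j₀ - b j₀ * Complex.I : ℂ).im = -b j₀ := by simp
  have hb₀ := hb j₀
  obtain ⟨x, hx⟩ := exists_prod_sub_neg hn1 hr
  obtain ⟨v, hv, hFx⟩ : ∃ v : ℝ, v < 0 ∧ F x = v := by
    refine ⟨(∏ i, (x - r i)) * ∏ j, ((x - a j) ^ 2 + b j ^ 2), mul_neg_of_neg_of_pos hx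
      (Finset.prod_pos fun j _ => ?_), by simp [hFdef]⟩
    have := hb j
    positivity
  have hbase : ((x : ℂ), (√(-v) : ℂ) * Complex.I) ∈
      {p : ℂ × ℂ | p.2 ^ 2 = F p.1} \ {p : ℂ × ℂ | p.1.im = 0 ∧ p.2.im = 0} := by
    refine ⟨?_, ?_⟩
    · have hs : ((√(-v) : ℝ) : ℂ) ^ 2 = -v := by
        exact_mod_cast Real.sq_sqrt (neg_pos.2 hv).le
      change _ ^ 2 = F x
      rw [hFx, mul_pow, hs, Complex.I_sq]
      ring
    · rintro ⟨-, h⟩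
      have h : √(-v) = 0 := by simpa using h
      exact (Real.sqrt_pos.2 (neg_pos.2 hv)).ne' h
  refine IsPathConnected.isConnected ⟨_, hbase, fun {p} hp => ?_⟩
  rcases le_total 0 p.1.im with him | him
  · exact (hF.joinedIn_zero hup (by rw [hupim]; exact hb₀.ne') hbase (by simp)).trans
      (hF.joinedIn_zero hup (by rw [hupim]; exact hb₀.ne') hp
        (by rw [hupim]; exact mul_nonneg him hb₀.le)).symm
  · exact (hF.joinedIn_zero hlow (by rw [hlowim]; exact (neg_neg_of_pos hb₀).ne) hbase
      (by simp)).trans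
      (hF.joinedIn_zero hlow (by rw [hlowim]; exact (neg_neg_of_pos hb₀).ne) hp
        (by rw [hlowim]; exact mul_nonneg_of_nonpos_of_nonpos him (neg_neg_of_pos hb₀).le)).symm
end

section
/- Let g ≥ 2 and let f(x) = ∏_{i=1}^{2g+2}(x − r_i), where r_1 < r_2 < ... < r_{2g+2} are distinct real numbers. Then the set {(x,y) ∈ ℂ × ℂ : y² = f(x)} \ (ℝ × ℝ) is not connected. -/
/-- A continuous function on `ℂ` that is a square root of `z` when `0 ≤ z.im`, and of the conjugate
of `z` otherwise. -/
noncomputable def upperSqrt (z : ℂ) : ℂ :=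
  ⟨√((‖z‖ + z.re) / 2), √((‖z‖ - z.re) / 2)⟩

theorem continuous_upperSqrt : Continuous upperSqrt := by
  have h : upperSqrt = fun z : ℂ ↦
      (√((‖z‖ + z.re) / 2) : ℂ) + (√((‖z‖ - z.re) / 2) : ℂ) * Complex.I := by
    funext z
    apply Complex.ext <;> simp [upperSqrt]
  rw [h]
  fun_prop

theorem upperSqrt_sq {z : ℂ} (hz : 0 ≤ z.im) : upperSqrt z ^ 2 = z := by
  have hre := abs_le.mp (Complex.abs_re_le_norm z)
  have hadd : 0 ≤ (‖z‖ + z.re) / 2 := by linarith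
  have hsub : 0 ≤ (‖z‖ - z.re) / 2 := by linarith
  have hmul : √((‖z‖ + z.re) / 2) * √((‖z‖ - z.re) / 2) = z.im / 2 := by
    rw [← Real.sqrt_mul hadd, ← Real.sqrt_sq (by linarith : 0 ≤ z.im / 2)]
    congr 1
    have := Complex.sq_norm z
    rw [Complex.normSq_apply] at this
    linarith
  apply Complex.ext
  · simp only [upperSqrt, pow_two, Complex.mul_re]
    rw [Real.mul_self_sqrt hadd, Real.mul_self_sqrt hsub]
    ring
  · simp only [upperSqrt, pow_two, Complex.mul_im]
    linarith

/-- If a continuous `G` is a square root of `f` on the closed upper half-plane, where `f` commutes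
with conjugation and has only real zeros, then the non-real part of the curve `y ^ 2 = f x` is
disconnected. -/
theorem not_isConnected_sq_eq_diff_real {f G : ℂ → ℂ} (hG : Continuous G)
    (hsq : ∀ x : ℂ, 0 ≤ x.im → G x ^ 2 = f x)
    (hconj : ∀ x, f (star x) = star (f x))
    (hzero : ∀ x, f x = 0 → x.im = 0) :
    ¬ IsConnected ({p : ℂ × ℂ | p.2 ^ 2 = f p.1} \ {p : ℂ × ℂ | p.1.im = 0 ∧ p.2.im = 0}) := by
  intro h
  have hsq' : ∀ x : ℂ, x.im ≤ 0 → star (G (star x)) ^ 2 = f x := by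
    intro x hx
    rw [← star_pow, hsq _ (by simpa using hx), hconj, star_star]
  have him : Continuous fun p : ℂ × ℂ ↦ p.1.im := Complex.continuous_im.comp continuous_fst
  let A : Set (ℂ × ℂ) := {p | 0 ≤ p.1.im ∧ p.2 = G p.1} ∪
    {p | p.1.im ≤ 0 ∧ p.2 = -star (G (star p.1))}
  let B : Set (ℂ × ℂ) := {p | 0 ≤ p.1.im ∧ p.2 = -G p.1} ∪
    {p | p.1.im ≤ 0 ∧ p.2 = star (G (star p.1))}
  have hA : IsClosed A :=
    ((isClosed_le continuous_const him).inter (isClosed_eq continuous_snd (by fun_prop))).union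
      ((isClosed_le him continuous_const).inter (isClosed_eq continuous_snd (by fun_prop)))
  have hB : IsClosed B :=
    ((isClosed_le continuous_const him).inter (isClosed_eq continuous_snd (by fun_prop))).union
      ((isClosed_le him continuous_const).inter (isClosed_eq continuous_snd (by fun_prop)))
  have hI : (0 : ℝ) ≤ Complex.I.im := by simp
  obtain ⟨⟨x, y⟩, ⟨hxy, hreal⟩, hpA, hpB⟩ := isPreconnected_closed_iff.mp h.isPreconnected A B hA hB
    (by
      rintro ⟨x, y⟩ ⟨hxy, -⟩
      simp only [Set.mem_ofPred_eq] at hxy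
      rcases le_total 0 x.im with hx | hx
      · rw [← hsq x hx] at hxy
        rcases sq_eq_sq_iff_eq_or_eq_neg.mp hxy with e | e
        · exact .inl (.inl ⟨hx, e⟩)
        · exact .inr (.inl ⟨hx, e⟩)
      · rw [← hsq' x hx] at hxy
        rcases sq_eq_sq_iff_eq_or_eq_neg.mp hxy with e | e
        · exact .inr (.inr ⟨hx, e⟩)
        · exact .inl (.inr ⟨hx, e⟩))
    ⟨(Complex.I, G Complex.I), ⟨hsq _ hI, by simp⟩, .inl ⟨hI, rfl⟩⟩
    ⟨(Complex.I, -G Complex.I), ⟨by simpa using hsq _ hI, by simp⟩, .inl ⟨hI, rfl⟩⟩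
  simp only [Set.mem_ofPred_eq] at hxy hreal
  have hy : y ≠ 0 := by
    rintro rfl
    exact hreal ⟨hzero x (by simpa using hxy.symm), rfl⟩
  have key : ∀ u : ℂ, x.im = 0 → y = u → y = star u → False := by
    intro u hx e₁ e₂
    refine hreal ⟨hx, Complex.conj_eq_iff_im.mp ?_⟩
    rw [e₁] at e₂ ⊢
    exact e₂.symm
  have hstar : x.im = 0 → star x = x := fun hx ↦ Complex.conj_eq_iff_im.mpr hx
  rcases hpA with ⟨h₁, e₁⟩ | ⟨h₁, e₁⟩ <;> rcases hpB with ⟨h₂, e₂⟩ | ⟨h₂, e₂⟩ <;>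
    dsimp only at h₁ e₁ h₂ e₂
  · exact hy (self_eq_neg.mp (e₂.trans (congrArg _ e₁.symm)))
  · have hx := le_antisymm h₂ h₁
    exact key _ hx e₁ (by rwa [hstar hx] at e₂)
  · have hx := le_antisymm h₁ h₂
    exact key _ hx e₂ (by rwa [hstar hx, ← star_neg] at e₁)
  · exact hy (self_eq_neg.mp (e₁.trans (congrArg _ e₂.symm)))

theorem complement_of_real_locus_disconnected_all_real (g : ℕ) (hg : 2 ≤ g)
    (r : Fin (2*g+2) → ℝ) (hr : StrictMono r) :
    ¬ IsConnected
      ({p : ℂ × ℂ | p.2 ^ 2 = ∏ i, (p.1 - (r i : ℂ))}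
        \ {p : ℂ × ℂ | p.1.im = 0 ∧ p.2.im = 0}) := by
  refine not_isConnected_sq_eq_diff_real (f := fun x ↦ ∏ i, (x - (r i : ℂ)))
    (G := fun x ↦ ∏ i, upperSqrt (x - r i)) ?_ ?_ ?_ ?_
  · exact continuous_finsetProd _ fun i _ ↦
      continuous_upperSqrt.comp (continuous_id.sub continuous_const)
  · intro x hx
    rw [← Finset.prod_pow]
    exact Finset.prod_congr rfl fun i _ ↦ upperSqrt_sq (by simpa using hx)
  · intro x
    simp
  · intro x hx
    obtain ⟨i, -, hi⟩ := Finset.prod_eq_zero_iff.mp hx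
    rw [sub_eq_zero.mp hi, Complex.ofReal_im]
end

section
/- Let g ≥ 2 and let f(x) = ∏_{j=1}^{g+1}((x − a_j)² + b_j²), where a_j ∈ ℝ, b_j > 0, and the 2g+2 complex roots a_1 ± i·b_1, ..., a_{g+1} ± i·b_{g+1} are pairwise distinct. Then the set {(x,y) ∈ ℂ × ℂ : y² = f(x)} \ (ℝ × ℝ) is not connected. -/
/-- A complex number whose square is a nonnegative real is real. -/
lemma Complex.im_eq_zero_of_sq_eq_ofReal {y : ℂ} {r : ℝ} (hr : 0 ≤ r) (h : y ^ 2 = (r : ℂ)) :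
    y.im = 0 := by
  have hre := congrArg Complex.re h
  have him := congrArg Complex.im h
  simp only [pow_two, Complex.mul_re, Complex.mul_im, Complex.ofReal_re,
    Complex.ofReal_im] at hre him
  have hprod : y.re * y.im = 0 := by linarith
  rcases mul_eq_zero.mp hprod with h0 | h0
  · rw [h0] at hre
    nlinarith
  · exact h0

theorem complement_of_real_locus_disconnected_no_real (g : ℕ) (hg : 2 ≤ g)
    (a b : Fin (g+1) → ℝ) (hb : ∀ j, 0 < b j)
    (hdist : Function.Injective
      (Sum.elim (fun j : Fin (g+1) => (a j : ℂ) + (b j : ℂ) * Complex.I)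
        (fun j : Fin (g+1) => (a j : ℂ) - (b j : ℂ) * Complex.I))) :
    ¬ IsConnected
      ({p : ℂ × ℂ | p.2 ^ 2 = ∏ j, ((p.1 - (a j : ℂ)) ^ 2 + ((b j : ℂ)) ^ 2)}
        \ {p : ℂ × ℂ | p.1.im = 0 ∧ p.2.im = 0}) := by
  intro hconn
  have himage := hconn.isPreconnected.image (fun p : ℂ × ℂ => p.1.im)
    (by fun_prop : Continuous fun p : ℂ × ℂ => p.1.im).continuousOn
  have hmem (x : ℂ) (hx : x.im ≠ 0) : x.im ∈ (fun p : ℂ × ℂ => p.1.im) ''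
      ({p : ℂ × ℂ | p.2 ^ 2 = ∏ j, ((p.1 - (a j : ℂ)) ^ 2 + ((b j : ℂ)) ^ 2)}
        \ {p : ℂ × ℂ | p.1.im = 0 ∧ p.2.im = 0}) := by
    obtain ⟨y, hy⟩ := IsAlgClosed.exists_pow_nat_eq
      (∏ j, ((x - (a j : ℂ)) ^ 2 + ((b j : ℂ)) ^ 2)) two_pos
    exact ⟨(x, y), ⟨hy, fun h => hx h.1⟩, rfl⟩
  obtain ⟨⟨x, y⟩, ⟨hcurve, hnonreal⟩, hx : x.im = 0⟩ :=
    himage.Icc_subset (hmem (-Complex.I) (by simp)) (hmem Complex.I (by simp))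
      (show (0 : ℝ) ∈ Set.Icc (-Complex.I).im Complex.I.im by simp)
  obtain ⟨t, rfl⟩ : ∃ t : ℝ, (t : ℂ) = x := ⟨x.re, Complex.ext rfl hx.symm⟩
  refine hnonreal ⟨hx, Complex.im_eq_zero_of_sq_eq_ofReal
    (r := ∏ j, ((t - a j) ^ 2 + b j ^ 2)) (Finset.prod_nonneg fun j _ => by positivity) ?_⟩
  push_cast
  exact hcurve
end
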